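/- Let α ≥ 0 and let ψ : ℝ² → ℂ be a compactly supported Lipschitz function such that ∫₀^{2π} ψ(r cos θ, r sin θ) dθ = 0 for every r > 0. Then ∫_{ℝ²} (1+|x|)^{-2α} |∇((1+|x|)^{α} ψ(x))|² dx ≥ ∫_{ℝ²} |x|^{-2} |ψ(x)|² dx. -/

import Mathlib

open MeasureTheory Real

lemma ac_ftc_aux {h h' : ℝ → ℂ} {a b : ℝ} (hf : AbsolutelyContinuousOnInterval h a b)
    (hi : IntervalIntegrable h' volume a b)
    (hd : ∀ᵐ x, x ∈ Set.uIcc a b → HasDerivAt h (h' x) x) (L : ℂ →L[ℝ] ℝ)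
    (hL : ∀ z, ‖L z‖ ≤ ‖z‖) :
    L (∫ x in a..b, h' x) = L (h b - h a) := by
  have hac : AbsolutelyContinuousOnInterval (fun x => L (h x)) a b := by
    rw [absolutelyContinuousOnInterval_iff] at hf ⊢
    intro ε hε
    obtain ⟨δ, hδ, H⟩ := hf ε hε
    refine ⟨δ, hδ, fun E hE hs => lt_of_le_of_lt (Finset.sum_le_sum fun i _ => ?_) (H E hE hs)⟩
    rw [dist_eq_norm, dist_eq_norm, ← map_sub]
    exact hL _
  rw [← L.intervalIntegral_comp_comm hi, map_sub, ← hac.integral_deriv_eq_sub]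
  apply intervalIntegral.integral_congr_ae
  filter_upwards [hd] with x hx hx'
  exact ((L.hasFDerivAt.comp_hasDerivAt x (hx (Set.uIoc_subset_uIcc hx'))).deriv).symm

lemma ac_ftc {h h' : ℝ → ℂ} {a b : ℝ} (hf : AbsolutelyContinuousOnInterval h a b)
    (hi : IntervalIntegrable h' volume a b)
    (hd : ∀ᵐ x, x ∈ Set.uIcc a b → HasDerivAt h (h' x) x) :
    ∫ x in a..b, h' x = h b - h a := by
  apply Complex.ext
  · exact ac_ftc_aux hf hi hd Complex.reCLM Complex.abs_re_le_norm
  · exact ac_ftc_aux hf hi hd Complex.imCLM Complex.abs_im_le_norm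

lemma wirtinger_real {g : ℝ → ℂ} {K : NNReal} (hg : LipschitzWith K g)
    (hper : g π = g (-π)) (hmean : ∫ θ in (-π)..π, g θ = 0) :
    ∫ θ in (-π)..π, ‖g θ‖ ^ 2 ≤ ∫ θ in (-π)..π, ‖deriv g θ‖ ^ 2 := by
  have hab : -π < π := by linarith [pi_pos]
  have hgm : MemLp g 2 (volume.restrict (Set.Ioc (-π) π)) := by
    obtain ⟨C, hC⟩ := (isCompact_Icc (a := -π) (b := π)).exists_bound_of_continuousOn
      hg.continuous.continuousOn
    refine MemLp.of_bound hg.continuous.aestronglyMeasurable C ?_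
    filter_upwards [ae_restrict_mem measurableSet_Ioc] with x hx
    exact hC x (Set.Ioc_subset_Icc_self hx)
  have hdm : MemLp (deriv g) 2 (volume.restrict (Set.Ioc (-π) π)) :=
    MemLp.of_bound (measurable_deriv g).aestronglyMeasurable K
      (Filter.Eventually.of_forall fun x => norm_deriv_le_of_lipschitz hg)
  have hdi : IntervalIntegrable (deriv g) volume (-π) π := by
    rw [intervalIntegrable_iff_integrableOn_Ioc_of_le hab.le]
    exact hdm.integrable (by norm_num)
  have s1 := hasSum_sq_fourierCoeffOn hab hgm
  have s2 := hasSum_sq_fourierCoeffOn hab hdm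
  have hT : 0 < π - -π := by linarith
  have key : ∀ n : ℤ, fourierCoeffOn hab (deriv g) n = Complex.I * n * fourierCoeffOn hab g n := by
    intro n
    have hfc : Continuous (fun x : ℝ => (fourier (-n) (x : AddCircle (π - -π)) : ℂ)) :=
      (map_continuous (fourier (-n))).comp (AddCircle.continuous_mk' _)
    have hac : AbsolutelyContinuousOnInterval
        (fun x : ℝ => (fourier (-n) (x : AddCircle (π - -π)) : ℂ) • g x) (-π) π := by
      have h1 : ContDiff ℝ 1 (fun x : ℝ => (fourier (-n) (x : AddCircle (π - -π)) : ℂ)) := by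
        simp_rw [fourier_coe_apply]
        have h0 : ContDiff ℝ 1 (fun x : ℝ => (x : ℂ)) := Complex.ofRealCLM.contDiff
        exact ((contDiff_const.mul h0).div_const _).cexp
      have h2 : AbsolutelyContinuousOnInterval g (-π) π :=
        (hg.lipschitzOnWith (s := Set.uIcc (-π) π)).absolutelyContinuousOnInterval
      exact h1.contDiffOn.absolutelyContinuousOnInterval.fun_smul h2
    have i1 : IntervalIntegrable (fun x : ℝ => (-2 * π * Complex.I * n / ((π - -π : ℝ) : ℂ)) *
        ((fourier (-n) (x : AddCircle (π - -π)) : ℂ) • g x)) volume (-π) π := by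
      apply Continuous.intervalIntegrable
      exact continuous_const.mul (hfc.smul hg.continuous)
    have i2 : IntervalIntegrable (fun x : ℝ => 
        ((fourier (-n) (x : AddCircle (π - -π)) : ℂ) • deriv g x)) volume (-π) π := by
      exact hdi.continuousOn_mul hfc.continuousOn
    have := ac_ftc hac (i1.add i2) (by
      filter_upwards [hg.ae_differentiableAt_real] with x hx _
      refine ((hasDerivAt_fourier_neg (π - -π) n x).smul hx.hasDerivAt).congr_deriv ?_
      simp only [smul_eq_mul]
      ring)
    have s2 : ((π : ℝ) : AddCircle (π - -π)) = ((-π : ℝ) : AddCircle (π - -π)) := by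
      have := AddCircle.coe_add_period (π - -π) (-π)
      rw [← this]; congr 1; ring
    rw [intervalIntegral.integral_add i1 i2, intervalIntegral.integral_const_mul, hper, s2, sub_self]
      at this
    rw [fourierCoeffOn_eq_integral, fourierCoeffOn_eq_integral]
    have h2 := eq_neg_of_add_eq_zero_right this
    rw [h2]
    have : ((π : ℝ) : ℂ) ≠ 0 := by exact_mod_cast pi_pos.ne'
    simp only [Complex.real_smul]
    push_cast
    field_simp
    ring
  have zero : fourierCoeffOn hab g 0 = 0 := by
    rw [fourierCoeffOn_eq_integral]
    simp [hmean]
  have hle : ∀ n : ℤ, ‖fourierCoeffOn hab g n‖ ^ 2 ≤ ‖fourierCoeffOn hab (deriv g) n‖ ^ 2 := by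
    intro n
    rcases eq_or_ne n 0 with rfl | hn
    · rw [zero]; simp
    · rw [key]
      have h1 : (1 : ℝ) ≤ ‖(n : ℂ)‖ := by
        rw [Complex.norm_intCast]
        exact_mod_cast Int.one_le_abs hn
      gcongr
      rw [norm_mul, norm_mul, Complex.norm_I, one_mul]
      exact le_mul_of_one_le_left (norm_nonneg _) h1
  have := hasSum_le hle s1 s2
  rw [smul_eq_mul, smul_eq_mul] at this
  exact le_of_mul_le_mul_left this (inv_pos.2 hT)

lemma wirtinger_lint {g : ℝ → ℂ} {K : NNReal} (hg : LipschitzWith K g)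
    (hper : g π = g (-π)) (hmean : ∫ θ in (-π)..π, g θ = 0) :
    ∫⁻ θ in Set.Ioo (-π) π, ENNReal.ofReal (‖g θ‖ ^ 2) ≤
      ∫⁻ θ in Set.Ioo (-π) π, ENNReal.ofReal (‖deriv g θ‖ ^ 2) := by
  have hab : -π < π := by linarith [pi_pos]
  have h := wirtinger_real hg hper hmean
  rw [intervalIntegral.integral_of_le hab.le, intervalIntegral.integral_of_le hab.le,
    integral_Ioc_eq_integral_Ioo, integral_Ioc_eq_integral_Ioo] at h
  rw [← ofReal_integral_eq_lintegral_ofReal, ← ofReal_integral_eq_lintegral_ofReal]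
  · exact ENNReal.ofReal_le_ofReal h
  · refine Measure.integrableOn_of_bounded (M := K ^ 2) (by simp)
      ((measurable_deriv g).norm.pow_const 2).aestronglyMeasurable
      (Filter.Eventually.of_forall fun x => ?_)
    rw [norm_pow, norm_norm]
    gcongr
    exact norm_deriv_le_of_lipschitz hg
  · exact Filter.Eventually.of_forall fun x => by positivity
  · exact ((hg.continuous.norm.pow 2).integrableOn_Icc).mono_set Set.Ioo_subset_Icc_self
  · exact Filter.Eventually.of_forall fun x => by positivity
lemma polar_bound {φ : ℂ → ℂ} {K : NNReal} (hφ : LipschitzWith K φ)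
    (horth : ∀ r : ℝ, 0 < r →
      ∫ θ in (0 : ℝ)..(2 * π), φ (r * (Real.cos θ + Real.sin θ * Complex.I)) = 0) :
    ∫⁻ z : ℂ, ENNReal.ofReal (‖z‖⁻¹ ^ 2 * ‖φ z‖ ^ 2) ≤
      ∫⁻ z : ℂ, ENNReal.ofReal (‖z‖⁻¹ ^ 2 *
        ‖deriv (fun t : ℝ => φ (z * (Real.cos t + Real.sin t * Complex.I))) 0‖ ^ 2) := by
  rw [← Complex.lintegral_comp_polarCoord_symm, ← Complex.lintegral_comp_polarCoord_symm]
  have htar : polarCoord.target = Set.Ioi (0 : ℝ) ×ˢ Set.Ioo (-π) π := rfl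
  have hF : Measurable (fun z : ℂ => ENNReal.ofReal (‖z‖⁻¹ ^ 2 *
        ‖deriv (fun t : ℝ => φ (z * (Real.cos t + Real.sin t * Complex.I))) 0‖ ^ 2)) := by
    have hc := hφ.continuous
    have h1 : Continuous (Function.uncurry (fun (z : ℂ) (t : ℝ) =>
        φ (z * (Real.cos t + Real.sin t * Complex.I)))) := by
      unfold Function.uncurry
      fun_prop
    have h2 := (measurable_deriv_with_param h1).comp (measurable_prodMk_right (y := (0 : ℝ)))
    have h3 : Measurable (fun z : ℂ =>
      deriv (fun t : ℝ => φ (z * (Real.cos t + Real.sin t * Complex.I))) 0) := h2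
    fun_prop
  have hsymm : Measurable (Complex.polarCoord.symm : ℝ × ℝ → ℂ) := by
    have : (Complex.polarCoord.symm : ℝ × ℝ → ℂ) =
        fun p => p.1 * (Real.cos p.2 + Real.sin p.2 * Complex.I) := by
      funext p; simp
    rw [this]; fun_prop
  rw [htar, Measure.volume_eq_prod, ← Measure.prod_restrict]
  refine (lintegral_prod_le _).trans ?_
  rw [lintegral_prod _ (by
    apply Measurable.aemeasurable
    exact (ENNReal.measurable_ofReal.comp measurable_fst).smul (hF.comp hsymm))]
  refine setLIntegral_mono' measurableSet_Ioi fun r hr => ?_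
  have hr : 0 < r := hr
  set g : ℝ → ℂ := fun t => φ (r * (Real.cos t + Real.sin t * Complex.I)) with hgdef
  have hnorm : ∀ t : ℝ, ‖Complex.polarCoord.symm (r, t)‖ = r := fun t => by
    rw [Complex.norm_polarCoord_symm]; exact abs_of_pos hr
  have hval : ∀ t : ℝ, φ (Complex.polarCoord.symm (r, t)) = g t := fun t => by
    simp [hgdef]
  have hder : ∀ θ : ℝ, deriv (fun t : ℝ => φ (Complex.polarCoord.symm (r, θ) *
      (Real.cos t + Real.sin t * Complex.I))) 0 = deriv g θ := fun θ => by
    have : (fun t : ℝ => φ (Complex.polarCoord.symm (r, θ) *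
      (Real.cos t + Real.sin t * Complex.I))) = fun t => g (θ + t) := by
      funext t
      simp only [hgdef, Complex.polarCoord_symm_apply]
      congr 1
      rw [mul_assoc]
      congr 1
      rw [Real.cos_add, Real.sin_add]
      push_cast
      linear_combination (Complex.sin θ * Complex.sin t) * Complex.I_sq
    rw [this, deriv_comp_const_add, add_zero]
  have hgl : LipschitzWith (K * r.toNNReal) g := by
    have h1 : LipschitzWith r.toNNReal
        (fun t : ℝ => (r * (Real.cos t + Real.sin t * Complex.I) : ℂ)) := by
      have hd : ∀ t : ℝ, HasDerivAt (fun t : ℝ => (r * (Real.cos t + Real.sin t * Complex.I) : ℂ))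
          (r * (-Real.sin t + Real.cos t * Complex.I)) t := fun t => by
        have c1 := (Real.hasDerivAt_cos t).ofReal_comp
        have c2 := (Real.hasDerivAt_sin t).ofReal_comp
        have := (c1.add (c2.mul_const Complex.I)).const_mul (r : ℂ)
        push_cast at this ⊢
        exact this
      apply lipschitzWith_of_nnnorm_deriv_le (fun t => (hd t).differentiableAt)
      intro t
      rw [(hd t).deriv, ← NNReal.coe_le_coe, coe_nnnorm, Real.coe_toNNReal _ hr.le, norm_mul,
        Complex.norm_real, Real.norm_of_nonneg hr.le]
      have : ‖(-(Real.sin t : ℂ) + Real.cos t * Complex.I)‖ = 1 := by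
        have h := Complex.norm_add_mul_I (-Real.sin t) (Real.cos t)
        push_cast at h ⊢
        rw [h]
        simp
      rw [this, mul_one]
    exact hφ.comp h1
  have hper : Function.Periodic g (2 * π) := fun t => by
    simp only [hgdef, Real.cos_add_two_pi, Real.sin_add_two_pi]
  have hW := wirtinger_lint hgl (by
      have := hper (-π)
      rw [← this]; congr 1; ring) (by
      have h1 := hper.intervalIntegral_add_eq (-π) 0
      rw [zero_add, horth r hr] at h1
      rw [← h1]; congr 1; ring)
  simp only [hnorm, hval, hder]
  have hs : ∀ c : ℝ, ENNReal.ofReal r • ENNReal.ofReal (r⁻¹ ^ 2 * c) =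
      ENNReal.ofReal (r * r⁻¹ ^ 2) * ENNReal.ofReal c := fun c => by
    rw [smul_eq_mul, ← ENNReal.ofReal_mul hr.le, ← ENNReal.ofReal_mul (by positivity), mul_assoc]
  simp only [hs]
  rw [lintegral_const_mul' _ _ ENNReal.ofReal_ne_top, lintegral_const_mul' _ _ ENNReal.ofReal_ne_top]
  gcongr

noncomputable def rotE (x : EuclideanSpace ℝ (Fin 2)) (t : ℝ) : EuclideanSpace ℝ (Fin 2) :=
  !₂[x 0 * Real.cos t - x 1 * Real.sin t, x 0 * Real.sin t + x 1 * Real.cos t]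

lemma polar_bound_E {ψ : EuclideanSpace ℝ (Fin 2) → ℂ} {K : NNReal} (hψ : LipschitzWith K ψ)
    (horth : ∀ r : ℝ, 0 < r →
      ∫ θ in (0:ℝ)..(2 * Real.pi),
        ψ ((EuclideanSpace.equiv (Fin 2) ℝ).symm ![r * Real.cos θ, r * Real.sin θ]) = 0) :
    ∫⁻ x : EuclideanSpace ℝ (Fin 2), ENNReal.ofReal (‖x‖⁻¹ ^ 2 * ‖ψ x‖ ^ 2) ≤
      ∫⁻ x : EuclideanSpace ℝ (Fin 2), ENNReal.ofReal (‖x‖⁻¹ ^ 2 *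
        ‖deriv (fun t : ℝ => ψ (rotE x t)) 0‖ ^ 2) := by
  set e := Complex.orthonormalBasisOneI.repr with he
  have hrot : ∀ (z : ℂ) (t : ℝ), e (z * (Real.cos t + Real.sin t * Complex.I)) = rotE (e z) t := by
    intro z t
    ext i
    fin_cases i <;> simp [he, rotE, -Complex.ofReal_cos, -Complex.ofReal_sin]
  have hmp := e.measurePreserving
  have hemb : MeasurableEmbedding e := e.toHomeomorph.measurableEmbedding
  rw [← hmp.lintegral_comp_emb hemb, ← hmp.lintegral_comp_emb hemb]
  have := polar_bound (φ := fun z => ψ (e z)) (hψ.comp e.lipschitz) (by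
    intro r hr
    rw [← horth r hr]
    congr 1
    funext θ
    congr 1
    ext i
    fin_cases i <;> simp [he, -Complex.ofReal_cos, -Complex.ofReal_sin])
  simpa only [LinearIsometryEquiv.norm_map, hrot] using this

lemma norm_rotE (x : EuclideanSpace ℝ (Fin 2)) (t : ℝ) : ‖rotE x t‖ = ‖x‖ := by
  rw [EuclideanSpace.norm_eq, EuclideanSpace.norm_eq]
  congr 1
  simp only [Fin.sum_univ_two, Real.norm_eq_abs, sq_abs, rotE]
  simp
  linear_combination (x 0 ^ 2 + x 1 ^ 2) * Real.sin_sq_add_cos_sq t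

lemma rotE_zero (x : EuclideanSpace ℝ (Fin 2)) : rotE x 0 = x := by
  ext i; fin_cases i <;> simp [rotE]

lemma hasDerivAt_rotE (x : EuclideanSpace ℝ (Fin 2)) :
    HasDerivAt (rotE x) (-x 1 • EuclideanSpace.single 0 1 + x 0 • EuclideanSpace.single 1 1) 0 := by
  set J : EuclideanSpace ℝ (Fin 2) :=
    -x 1 • EuclideanSpace.single 0 1 + x 0 • EuclideanSpace.single 1 1 with hJ
  have h : rotE x = fun t => Real.cos t • x + Real.sin t • J := by
    funext t
    ext i
    fin_cases i <;> simp [rotE, hJ] <;> ring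
  rw [h]
  refine (((Real.hasDerivAt_cos 0).smul_const x).add
    ((Real.hasDerivAt_sin 0).smul_const J)).congr_deriv ?_
  simp

lemma deriv_rot {f : EuclideanSpace ℝ (Fin 2) → ℂ} {x : EuclideanSpace ℝ (Fin 2)}
    (hf : DifferentiableAt ℝ f x) :
    deriv (fun t => f (rotE x t)) 0 =
      -x 1 • fderiv ℝ f x (EuclideanSpace.single 0 1) +
        x 0 • fderiv ℝ f x (EuclideanSpace.single 1 1) := by
  have h1 : HasFDerivAt f (fderiv ℝ f x) (rotE x 0) := by
    rw [rotE_zero]; exact hf.hasFDerivAt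
  have := (h1.comp_hasDerivAt 0 (hasDerivAt_rotE x)).deriv
  rw [map_add, map_smul, map_smul] at this
  exact this

lemma hasFDerivAt_weight (α : ℝ) {x : EuclideanSpace ℝ (Fin 2)} (hx : x ≠ 0) :
    HasFDerivAt (fun y : EuclideanSpace ℝ (Fin 2) => (1 + ‖y‖) ^ α)
      ((α * (1 + ‖x‖) ^ (α - 1)) • fderiv ℝ (fun y : EuclideanSpace ℝ (Fin 2) => ‖y‖) x) x := by
  have h1 : HasFDerivAt (fun y : EuclideanSpace ℝ (Fin 2) => ‖y‖) _ x :=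
    (differentiableAt_id.norm ℝ hx).hasFDerivAt
  have h2 : 1 + ‖x‖ ≠ 0 := by positivity
  exact (h1.const_add 1).rpow_const (Or.inl h2)

lemma differentiableAt_wpsi (α : ℝ) {ψ : EuclideanSpace ℝ (Fin 2) → ℂ}
    {x : EuclideanSpace ℝ (Fin 2)} (hx : x ≠ 0) (hd : DifferentiableAt ℝ ψ x) :
    DifferentiableAt ℝ (fun y => ((1 + ‖y‖) ^ α : ℝ) • ψ y) x :=
  (hasFDerivAt_weight α hx).differentiableAt.smul hd

lemma pointwise_bound (α : ℝ) {ψ : EuclideanSpace ℝ (Fin 2) → ℂ}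
    {x : EuclideanSpace ℝ (Fin 2)} (hx : x ≠ 0) (hd : DifferentiableAt ℝ ψ x) :
    ‖x‖⁻¹ ^ 2 * ‖deriv (fun t : ℝ => ψ (rotE x t)) 0‖ ^ 2 ≤
      (1 + ‖x‖) ^ (-(2 * α)) *
          (‖fderiv ℝ (fun y => ((1 + ‖y‖) ^ α : ℝ) • ψ y) x
              (EuclideanSpace.single 0 1)‖ ^ 2 +
            ‖fderiv ℝ (fun y => ((1 + ‖y‖) ^ α : ℝ) • ψ y) x
              (EuclideanSpace.single 1 1)‖ ^ 2) := by
  have h1 := deriv_rot (differentiableAt_wpsi α hx hd)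
  simp only [norm_rotE] at h1
  set a := fderiv ℝ (fun y => ((1 + ‖y‖) ^ α : ℝ) • ψ y) x (EuclideanSpace.single 0 1)
  set b := fderiv ℝ (fun y => ((1 + ‖y‖) ^ α : ℝ) • ψ y) x (EuclideanSpace.single 1 1)
  rw [deriv_fun_const_smul_field] at h1
  set d := deriv (fun t : ℝ => ψ (rotE x t)) 0
  have hxp : 0 < ‖x‖ := norm_pos_iff.2 hx
  have hw : 0 < 1 + ‖x‖ := by positivity
  have hxs : ‖x‖ ^ 2 = x 0 ^ 2 + x 1 ^ 2 := by
    rw [EuclideanSpace.norm_sq_eq]; simp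
  have h2 : (1 + ‖x‖) ^ α * ‖d‖ ≤ |x 1| * ‖a‖ + |x 0| * ‖b‖ := by
    calc (1 + ‖x‖) ^ α * ‖d‖ = ‖((1 + ‖x‖) ^ α : ℝ) • d‖ := by
          rw [norm_smul, Real.norm_of_nonneg (by positivity)]
      _ ≤ _ := by
          rw [h1]
          refine (norm_add_le _ _).trans ?_
          rw [norm_smul, norm_smul]; simp
  have h3 : ((1 + ‖x‖) ^ α * ‖d‖) ^ 2 ≤ ‖x‖ ^ 2 * (‖a‖ ^ 2 + ‖b‖ ^ 2) := by
    refine (pow_le_pow_left₀ (by positivity) h2 2).trans ?_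
    rw [hxs, ← sq_abs (x 0), ← sq_abs (x 1)]
    nlinarith [sq_nonneg (|x 1| * ‖b‖ - |x 0| * ‖a‖)]
  have h4 : (1 + ‖x‖) ^ (-(2 * α)) * ((1 + ‖x‖) ^ α) ^ 2 = 1 := by
    rw [← Real.rpow_natCast, ← Real.rpow_mul hw.le, ← Real.rpow_add hw]
    simp [mul_comm]
  calc ‖x‖⁻¹ ^ 2 * ‖d‖ ^ 2
      = (1 + ‖x‖) ^ (-(2 * α)) * (‖x‖⁻¹ ^ 2 * ((1 + ‖x‖) ^ α * ‖d‖) ^ 2) := by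
        linear_combination (-(‖x‖⁻¹ ^ 2 * ‖d‖ ^ 2)) * h4
    _ ≤ (1 + ‖x‖) ^ (-(2 * α)) * (‖x‖⁻¹ ^ 2 * (‖x‖ ^ 2 * (‖a‖ ^ 2 + ‖b‖ ^ 2))) := by
        gcongr
    _ = _ := by field_simp

lemma fderiv_bound (α : ℝ) (hα : 0 ≤ α) {ψ : EuclideanSpace ℝ (Fin 2) → ℂ} {K : NNReal}
    (hψ : LipschitzWith K ψ)
    {x : EuclideanSpace ℝ (Fin 2)} (hx : x ≠ 0) (hd : DifferentiableAt ℝ ψ x)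
    (v : EuclideanSpace ℝ (Fin 2)) (hv : ‖v‖ = 1) :
    ‖fderiv ℝ (fun y => ((1 + ‖y‖) ^ α : ℝ) • ψ y) x v‖ ≤
      (1 + ‖x‖) ^ α * K + α * (1 + ‖x‖) ^ (α - 1) * ‖ψ x‖ := by
  have h := ((hasFDerivAt_weight α hx).smul hd.hasFDerivAt).fderiv
  have h' : fderiv ℝ (fun y => ((1 + ‖y‖) ^ α : ℝ) • ψ y) x = _ := h
  rw [h']
  have h1 : ‖fderiv ℝ ψ x v‖ ≤ K := by
    refine ((fderiv ℝ ψ x).le_opNorm v).trans ?_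
    rw [hv, mul_one]; exact norm_fderiv_le_of_lipschitz ℝ hψ
  have h2 : ‖fderiv ℝ (fun y : EuclideanSpace ℝ (Fin 2) => ‖y‖) x v‖ ≤ 1 := by
    refine (ContinuousLinearMap.le_opNorm _ v).trans ?_
    rw [hv, mul_one]
    exact_mod_cast norm_fderiv_le_of_lipschitz ℝ (lipschitzWith_one_norm (E := EuclideanSpace ℝ (Fin 2)))
  simp only [add_apply, smul_apply,
    ContinuousLinearMap.smulRight_apply]
  refine (norm_add_le _ _).trans ?_
  rw [norm_smul, norm_smul, norm_smul, Real.norm_of_nonneg (by positivity : 0 ≤ (1 + ‖x‖) ^ α),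
    Real.norm_of_nonneg (by positivity : 0 ≤ α * (1 + ‖x‖) ^ (α - 1))]
  have h3 : α * (1 + ‖x‖) ^ (α - 1) * ‖fderiv ℝ (fun y : EuclideanSpace ℝ (Fin 2) => ‖y‖) x v‖ ≤
      α * (1 + ‖x‖) ^ (α - 1) := mul_le_of_le_one_right (by positivity) h2
  exact add_le_add (mul_le_mul_of_nonneg_left h1 (by positivity))
    (mul_le_mul_of_nonneg_right h3 (norm_nonneg _))

lemma ae_good {ψ : EuclideanSpace ℝ (Fin 2) → ℂ} {K : NNReal} (hψ : LipschitzWith K ψ) :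
    ∀ᵐ x : EuclideanSpace ℝ (Fin 2), x ≠ 0 ∧ DifferentiableAt ℝ ψ x := by
  have h0 : ∀ᵐ x : EuclideanSpace ℝ (Fin 2), x ≠ 0 := Measure.ae_ne volume 0
  filter_upwards [h0, hψ.ae_differentiableAt] with x h1 h2 using ⟨h1, h2⟩

lemma measurable_lhs (α : ℝ) (ψ : EuclideanSpace ℝ (Fin 2) → ℂ) :
    Measurable (fun x : EuclideanSpace ℝ (Fin 2) => (1 + ‖x‖) ^ (-(2 * α)) *
          (‖fderiv ℝ (fun y => ((1 + ‖y‖) ^ α : ℝ) • ψ y) x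
              (EuclideanSpace.single 0 1)‖ ^ 2 +
            ‖fderiv ℝ (fun y => ((1 + ‖y‖) ^ α : ℝ) • ψ y) x
              (EuclideanSpace.single 1 1)‖ ^ 2)) := by
  have h := fun v => measurable_fderiv_apply_const ℝ
    (fun y : EuclideanSpace ℝ (Fin 2) => ((1 + ‖y‖) ^ α : ℝ) • ψ y) v
  exact ((measurable_const.add measurable_norm).pow_const _).mul
    (((h _).norm.pow_const 2).add ((h _).norm.pow_const 2))

lemma integrable_lhs (α : ℝ) (hα : 0 ≤ α) {ψ : EuclideanSpace ℝ (Fin 2) → ℂ} {K : NNReal}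
    (hψ : LipschitzWith K ψ) (hsupp : HasCompactSupport ψ) :
    Integrable (fun x : EuclideanSpace ℝ (Fin 2) => (1 + ‖x‖) ^ (-(2 * α)) *
          (‖fderiv ℝ (fun y => ((1 + ‖y‖) ^ α : ℝ) • ψ y) x
              (EuclideanSpace.single 0 1)‖ ^ 2 +
            ‖fderiv ℝ (fun y => ((1 + ‖y‖) ^ α : ℝ) • ψ y) x
              (EuclideanSpace.single 1 1)‖ ^ 2)) := by
  have hs : (Function.support (fun x : EuclideanSpace ℝ (Fin 2) => (1 + ‖x‖) ^ (-(2 * α)) *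
          (‖fderiv ℝ (fun y => ((1 + ‖y‖) ^ α : ℝ) • ψ y) x
              (EuclideanSpace.single 0 1)‖ ^ 2 +
            ‖fderiv ℝ (fun y => ((1 + ‖y‖) ^ α : ℝ) • ψ y) x
              (EuclideanSpace.single 1 1)‖ ^ 2))) ⊆ tsupport ψ := by
    intro x hx
    by_contra hn
    apply hx
    have h1 : x ∉ tsupport (fun y => ((1 + ‖y‖) ^ α : ℝ) • ψ y) :=
      fun h => hn (tsupport_smul_subset_right _ _ h)
    have h2 : fderiv ℝ (fun y => ((1 + ‖y‖) ^ α : ℝ) • ψ y) x = 0 := fderiv_of_notMem_tsupport ℝ h1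
    simp only [h2, zero_apply, norm_zero]
    ring
  rw [← integrableOn_iff_integrable_of_support_subset hs]
  have hp : ∀ x : EuclideanSpace ℝ (Fin 2), 1 + ‖x‖ ≠ 0 := fun x => by positivity
  have hc : ∀ β : ℝ, Continuous (fun x : EuclideanSpace ℝ (Fin 2) => (1 + ‖x‖) ^ β) := fun β =>
    (continuous_const.add continuous_norm).rpow_const fun x => Or.inl (hp x)
  have hB : Continuous (fun x : EuclideanSpace ℝ (Fin 2) => (1 + ‖x‖) ^ (-(2 * α)) *
      (((1 + ‖x‖) ^ α * K + α * (1 + ‖x‖) ^ (α - 1) * ‖ψ x‖) ^ 2 +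
      ((1 + ‖x‖) ^ α * K + α * (1 + ‖x‖) ^ (α - 1) * ‖ψ x‖) ^ 2)) := by
    have h1 := hc (-(2 * α))
    have h2 := hc α
    have h3 := hc (α - 1)
    have h4 := hψ.continuous
    fun_prop
  refine Integrable.mono' (hB.continuousOn.integrableOn_compact hsupp)
    (measurable_lhs α ψ).aestronglyMeasurable ?_
  filter_upwards [ae_restrict_of_ae (ae_good hψ)] with x hx
  rw [Real.norm_of_nonneg (by positivity)]
  have b0 := fderiv_bound α hα hψ hx.1 hx.2 (EuclideanSpace.single 0 1) (by simp)
  have b1 := fderiv_bound α hα hψ hx.1 hx.2 (EuclideanSpace.single 1 1) (by simp)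
  gcongr

/-- Proof step of Proposition 4.1: for `α ≥ 0` and `ψ` with vanishing angular
averages, the weighted Dirichlet integral of `(1+|x|)^α ψ` dominates the Hardy term
`∫ |x|⁻² |ψ|²`. -/
theorem weighted_dirichlet_hardy_bound_orthogonal_radial
    (α : ℝ) (hα : 0 ≤ α)
    (ψ : EuclideanSpace ℝ (Fin 2) → ℂ) (K : NNReal)
    (hψ : LipschitzWith K ψ) (hsupp : HasCompactSupport ψ)
    (horth : ∀ r : ℝ, 0 < r →
      ∫ θ in (0:ℝ)..(2 * Real.pi),
        ψ ((EuclideanSpace.equiv (Fin 2) ℝ).symm ![r * Real.cos θ, r * Real.sin θ]) = 0) :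
    ∫ x : EuclideanSpace ℝ (Fin 2),
        (1 + ‖x‖) ^ (-(2 * α)) *
          (‖fderiv ℝ (fun y => ((1 + ‖y‖) ^ α : ℝ) • ψ y) x
              (EuclideanSpace.single 0 1)‖ ^ 2 +
            ‖fderiv ℝ (fun y => ((1 + ‖y‖) ^ α : ℝ) • ψ y) x
              (EuclideanSpace.single 1 1)‖ ^ 2) ≥
      ∫ x : EuclideanSpace ℝ (Fin 2), ‖x‖⁻¹ ^ 2 * ‖ψ x‖ ^ 2 := by
  have hi := integrable_lhs α hα hψ hsupp
  rw [ge_iff_le, integral_eq_lintegral_of_nonneg_ae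
    (Filter.Eventually.of_forall fun x => by positivity)
    (by
      have := hψ.continuous
      have h : Measurable (fun x : EuclideanSpace ℝ (Fin 2) => ‖x‖⁻¹ ^ 2 * ‖ψ x‖ ^ 2) :=
        (measurable_norm.inv.pow_const 2).mul (this.measurable.norm.pow_const 2)
      exact h.aestronglyMeasurable),
    integral_eq_lintegral_of_nonneg_ae (Filter.Eventually.of_forall fun x => by positivity)
      (measurable_lhs α ψ).aestronglyMeasurable]
  refine ENNReal.toReal_mono ?_ ((polar_bound_E hψ horth).trans ?_)
  · exact hi.lintegral_lt_top.ne
  · refine lintegral_mono_ae ?_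
    filter_upwards [ae_good hψ] with x hx
    exact ENNReal.ofReal_le_ofReal (pointwise_bound α hx.1 hx.2)
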